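/- Fourth-order proximity of the discrete spectrum: for every eigenvalue λ of the clamped biharmonic operator on [0,1], there exist constants C > 0 and h₀ > 0 such that for every integer N with h = 1/N < h₀, there exists an eigenvalue μ of the matrix K^h with |λ⁻¹ − μ| ≤ C·h⁴. -/

import Mathlib

open Set

/-- `lam` is an eigenvalue of the clamped biharmonic operator on `[0,1]`. -/
def IsClampedBiharmonicEV (lam : ℝ) : Prop :=
  ∃ φ : ℝ → ℝ, ContDiff ℝ 4 φ ∧ (∃ x ∈ Set.Icc (0:ℝ) 1, φ x ≠ 0) ∧
    (∀ x ∈ Set.Icc (0:ℝ) 1, iteratedDeriv 4 φ x = lam * φ x) ∧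
    φ 0 = 0 ∧ deriv φ 0 = 0 ∧ φ 1 = 0 ∧ deriv φ 1 = 0

/-- Green's kernel of the clamped biharmonic operator on `[0,1]`. -/
noncomputable def Kgreen (x y : ℝ) : ℝ :=
  if y ≤ x then (1/6) * (1 - x)^2 * y^2 * (2*x*(1 - y) + x - y)
  else (1/6) * x^2 * (1 - y)^2 * (2*y*(1 - x) + y - x)

/-- The `(N-1)×(N-1)` matrix `K^h` with entries `K^h_{i,j} = h·K(x_i, x_j)`, `h = 1/N`. -/
noncomputable def Kmat (N : ℕ) : Matrix (Fin (N-1)) (Fin (N-1)) ℝ :=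
  fun i j => ((1:ℝ)/N) * Kgreen (((i : ℕ) + 1 : ℝ) / N) (((j : ℕ) + 1 : ℝ) / N)

/-- If the derivative of `f` is bounded by `C` on `[0,t]` and `f 0 = 0`, then `|f t| ≤ C t`. -/
theorem abs_le_mul_of_abs_deriv_le_on {f f' : ℝ → ℝ} {C t : ℝ} (ht : 0 ≤ t)
    (hf : ∀ s ∈ Icc 0 t, HasDerivAt f (f' s) s) (hC : ∀ s ∈ Icc 0 t, |f' s| ≤ C)
    (h0 : f 0 = 0) : |f t| ≤ C * t := by
  have := (convex_Icc (0:ℝ) t).norm_image_sub_le_of_norm_hasDerivWithin_le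
    (fun s hs => (hf s hs).hasDerivWithinAt) hC ⟨le_refl 0, ht⟩ ⟨ht, le_refl t⟩
  simpa [h0, abs_of_nonneg ht] using this

/-- `abs_le_mul_of_abs_deriv_le_on` for a function differentiable everywhere. -/
theorem abs_le_mul_of_abs_deriv_le {f f' : ℝ → ℝ} {C t : ℝ} (ht : 0 ≤ t)
    (hf : ∀ s, HasDerivAt f (f' s) s) (hC : ∀ s ∈ Icc 0 t, |f' s| ≤ C) (h0 : f 0 = 0) :
    |f t| ≤ C * t :=
  abs_le_mul_of_abs_deriv_le_on ht (fun s _ => hf s) hC h0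

/-- Corrected trapezoidal rule on one cell, for an integrand `g` with antiderivative `G`. -/
theorem corrected_trapezoid_error {G g g₁ g₂ g₃ g₄ : ℝ → ℝ} {a t M : ℝ} (ht : 0 ≤ t)
    (hG : ∀ y ∈ Icc a (a + t), HasDerivAt G (g y) y) (hg : ∀ y, HasDerivAt g (g₁ y) y)
    (hg₁ : ∀ y, HasDerivAt g₁ (g₂ y) y) (hg₂ : ∀ y, HasDerivAt g₂ (g₃ y) y)
    (hg₃ : ∀ y, HasDerivAt g₃ (g₄ y) y) (hM : ∀ y ∈ Icc a (a + t), |g₄ y| ≤ M) :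
    |t / 2 * (g a + g (a + t)) - ((G (a + t) + t ^ 2 / 12 * g₁ (a + t))
      - (G a + t ^ 2 / 12 * g₁ a))| ≤ M * t ^ 5 := by
  have hM0 : 0 ≤ M := (abs_nonneg _).trans (hM a ⟨le_refl a, by linarith⟩)
  have sh : ∀ {f f' : ℝ → ℝ} {s : ℝ}, HasDerivAt f (f' (a + s)) (a + s) →
      HasDerivAt (fun s => f (a + s)) (f' (a + s)) s := fun h => by
    simpa using h.comp_const_add a _
  have mem : ∀ {s r : ℝ}, s ∈ Icc 0 t → r ∈ Icc 0 s → r ∈ Icc 0 t := fun h k =>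
    ⟨k.1, k.2.trans h.2⟩
  have mem' : ∀ {s : ℝ}, s ∈ Icc 0 t → a + s ∈ Icc a (a + t) := fun h =>
    ⟨by linarith [h.1], by linarith [h.2]⟩
  have e₂ : ∀ s ∈ Icc 0 t,
      |s / 6 * g₂ (a + s) - 1 / 6 * (g₁ (a + s) - g₁ a) - s ^ 2 / 12 * g₃ (a + s)|
        ≤ M * t ^ 2 * t := by
    intro s hs
    refine (abs_le_mul_of_abs_deriv_le (C := M * t ^ 2)
      (f := fun s => s / 6 * g₂ (a + s) - 1 / 6 * (g₁ (a + s) - g₁ a)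
        - s ^ 2 / 12 * g₃ (a + s))
      (f' := fun s => - (s ^ 2 / 12) * g₄ (a + s)) hs.1 ?_ ?_ (by simp)).trans ?_
    · intro r
      have := (((hasDerivAt_id r).div_const 6).mul (sh (hg₂ (a + r)))).sub
        (((sh (hg₁ (a + r))).sub_const (g₁ a)).const_mul (1 / 6)) |>.sub
        ((((hasDerivAt_id r).pow 2).div_const 12).mul (sh (hg₃ (a + r))))
      refine this.congr_deriv ?_
      simp only [id, Pi.pow_apply]
      ring
    · intro r hr
      have h1 := hM _ (mem' (mem hs hr))
      rw [abs_mul, abs_neg, abs_of_nonneg (by positivity : (0:ℝ) ≤ r ^ 2 / 12), mul_comm]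
      have : r ^ 2 ≤ t ^ 2 := pow_le_pow_left₀ hr.1 (mem hs hr).2 2
      gcongr
      nlinarith [sq_nonneg r]
    · have := hs.2
      gcongr
  have e₁ : ∀ s ∈ Icc 0 t,
      |1 / 2 * (g a - g (a + s)) + s / 2 * g₁ (a + s) - s / 6 * (g₁ (a + s) - g₁ a)
        - s ^ 2 / 12 * g₂ (a + s)| ≤ M * t ^ 2 * t * t := by
    intro s hs
    refine (abs_le_mul_of_abs_deriv_le
      (f := fun s => 1 / 2 * (g a - g (a + s)) + s / 2 * g₁ (a + s)
        - s / 6 * (g₁ (a + s) - g₁ a) - s ^ 2 / 12 * g₂ (a + s))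
      (f' := fun s => s / 6 * g₂ (a + s) - 1 / 6 * (g₁ (a + s) - g₁ a)
        - s ^ 2 / 12 * g₃ (a + s)) hs.1 ?_ (fun r hr => e₂ r (mem hs hr)) (by simp)).trans ?_
    · intro r
      have := ((((sh (hg (a + r))).const_sub (g a)).const_mul (1 / 2)).add
        (((hasDerivAt_id r).div_const 2).mul (sh (hg₁ (a + r))))).sub
        (((hasDerivAt_id r).div_const 6).mul ((sh (hg₁ (a + r))).sub_const (g₁ a))) |>.sub
        ((((hasDerivAt_id r).pow 2).div_const 12).mul (sh (hg₂ (a + r))))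
      refine this.congr_deriv ?_
      simp only [id, Pi.pow_apply]
      ring
    · have := hs.2
      gcongr
  have e₀ := abs_le_mul_of_abs_deriv_le_on
      (f := fun s => s / 2 * (g a + g (a + s)) - (G (a + s) - G a)
        - s ^ 2 / 12 * (g₁ (a + s) - g₁ a))
      (f' := fun s => 1 / 2 * (g a - g (a + s)) + s / 2 * g₁ (a + s)
        - s / 6 * (g₁ (a + s) - g₁ a) - s ^ 2 / 12 * g₂ (a + s)) ht (by
      intro r hr
      have := ((((hasDerivAt_id r).div_const 2).mul ((sh (hg (a + r))).const_add (g a))).sub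
        ((sh (hG (a + r) (mem' hr))).sub_const (G a))).sub
        ((((hasDerivAt_id r).pow 2).div_const 12).mul ((sh (hg₁ (a + r))).sub_const (g₁ a)))
      refine this.congr_deriv ?_
      simp only [id, Pi.pow_apply]
      ring) e₁ (by simp)
  convert e₀ using 1
  · congr 1
    ring
  · ring

/-- Cellwise comparison with a telescoping sum. -/
theorem abs_sum_sub_telescope_le {N : ℕ} {a H : ℕ → ℝ} {e : ℝ}
    (h : ∀ j < N, |a j - (H (j + 1) - H j)| ≤ e) :
    |∑ j ∈ Finset.range N, a j - (H N - H 0)| ≤ N * e := by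
  rw [← Finset.sum_range_sub, ← Finset.sum_sub_distrib]
  refine (Finset.abs_sum_le_sum_abs _ _).trans ?_
  refine (Finset.sum_le_sum fun j hj => h j (Finset.mem_range.1 hj)).trans ?_
  simp

/-- A trapezoidal sum of values vanishing at both ends is a plain sum over the interior. -/
theorem trapezoid_sum_eq {N : ℕ} (hN : 2 ≤ N) (f : ℕ → ℝ) (h : ℝ) (h0 : f 0 = 0)
    (hf : f N = 0) :
    ∑ j ∈ Finset.range N, h / 2 * (f j + f (j + 1)) = ∑ j : Fin (N - 1), h * f (j + 1) := by
  obtain ⟨n, rfl⟩ : ∃ n, N = n + 1 := ⟨N - 1, by omega⟩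
  rw [Nat.add_sub_cancel, Fin.sum_univ_eq_sum_range (fun j => h * f (j + 1)) n,
    ← Finset.mul_sum, Finset.sum_add_distrib, Finset.sum_range_succ', Finset.sum_range_succ
    (fun j => f (j + 1)), h0, hf, ← Finset.mul_sum]
  ring

/-- A symmetric matrix has an eigenvalue within the relative residual of any approximate
eigenpair `(β, v)`. -/
theorem exists_eigenvalue_near {n : Type*} [Fintype n] [DecidableEq n] [Nonempty n]
    {A : Matrix n n ℝ} (hA : A.IsHermitian) (β : ℝ) (v : n → ℝ) :
    ∃ i, (β - hA.eigenvalues i) ^ 2 * ∑ j, v j ^ 2 ≤ ∑ j, ((A.mulVec v) j - β * v j) ^ 2 := by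
  obtain ⟨i, hi⟩ := Finite.exists_min fun i => (β - hA.eigenvalues i) ^ 2
  refine ⟨i, ?_⟩
  set b := hA.eigenvectorBasis
  set w : EuclideanSpace ℝ n := WithLp.toLp 2 v
  set r : EuclideanSpace ℝ n := WithLp.toLp 2 (A.mulVec v - β • v)
  have key : ∀ k, inner ℝ (b k) r = (hA.eigenvalues k - β) * inner ℝ (b k) w := by
    intro k
    have h1 := hA.mulVec_eigenvectorBasis k
    have h2 : A.mulVec v ⬝ᵥ (b k).ofLp = hA.eigenvalues k * (v ⬝ᵥ (b k).ofLp) := by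
      have hT : A.transpose = A := by simpa [Matrix.IsHermitian] using hA
      rw [dotProduct_comm, Matrix.dotProduct_mulVec, ← Matrix.mulVec_transpose, hT, h1,
        smul_dotProduct, dotProduct_comm, smul_eq_mul]
    simp only [EuclideanSpace.inner_eq_star_dotProduct, r, w, star_trivial]
    rw [sub_dotProduct, h2, smul_dotProduct, smul_eq_mul]
    ring
  have hw : ∑ j, v j ^ 2 = ∑ k, (inner ℝ (b k) w) ^ 2 := by
    have := b.sum_sq_norm_inner_right w
    simp only [Real.norm_eq_abs, sq_abs] at this
    rw [this, EuclideanSpace.real_norm_sq_eq]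
  have hr : ∑ j, ((A.mulVec v) j - β * v j) ^ 2 = ∑ k, (inner ℝ (b k) r) ^ 2 := by
    have := b.sum_sq_norm_inner_right r
    simp only [Real.norm_eq_abs, sq_abs] at this
    rw [this, EuclideanSpace.real_norm_sq_eq]
    simp [r]
  rw [hw, hr, Finset.mul_sum]
  refine Finset.sum_le_sum fun k _ => ?_
  rw [key, mul_pow, ← neg_sq (hA.eigenvalues k - β), neg_sub]
  exact mul_le_mul_of_nonneg_right (hi k) (sq_nonneg _)

/-- The cubic polynomial with coefficients `c`. -/
def cubic (c : Fin 4 → ℝ) (y : ℝ) : ℝ := c 0 + c 1 * y + c 2 * y ^ 2 + c 3 * y ^ 3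

/-- The first derivative of `cubic c`. -/
def cubic' (c : Fin 4 → ℝ) (y : ℝ) : ℝ := c 1 + 2 * c 2 * y + 3 * c 3 * y ^ 2

/-- The second derivative of `cubic c`. -/
def cubic'' (c : Fin 4 → ℝ) (y : ℝ) : ℝ := 2 * c 2 + 6 * c 3 * y

theorem hasDerivAt_cubic (c : Fin 4 → ℝ) (y : ℝ) : HasDerivAt (cubic c) (cubic' c y) y := by
  have := (((hasDerivAt_id y).const_mul (c 1)).const_add (c 0)).add
    (((hasDerivAt_id y).pow 2).const_mul (c 2)) |>.add
    (((hasDerivAt_id y).pow 3).const_mul (c 3))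
  refine this.congr_deriv ?_
  simp only [id, cubic']
  ring

theorem hasDerivAt_cubic' (c : Fin 4 → ℝ) (y : ℝ) : HasDerivAt (cubic' c) (cubic'' c y) y := by
  have := (((hasDerivAt_id y).const_mul (2 * c 2)).const_add (c 1)).add
    (((hasDerivAt_id y).pow 2).const_mul (3 * c 3))
  refine this.congr_deriv ?_
  simp only [id, cubic'']
  ring

theorem hasDerivAt_cubic'' (c : Fin 4 → ℝ) (y : ℝ) : HasDerivAt (cubic'' c) (6 * c 3) y := by
  have := ((hasDerivAt_id y).const_mul (6 * c 3)).const_add (2 * c 2)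
  refine this.congr_deriv ?_
  simp

/-- The boundary form of repeated integration by parts: an antiderivative of
`cubic c * f 4`. -/
def parts (c : Fin 4 → ℝ) (f : ℕ → ℝ → ℝ) (y : ℝ) : ℝ :=
  cubic c y * f 3 y - cubic' c y * f 2 y + cubic'' c y * f 1 y - 6 * c 3 * f 0 y

theorem hasDerivAt_parts (c : Fin 4 → ℝ) {f : ℕ → ℝ → ℝ}
    (hf : ∀ k < 4, ∀ y, HasDerivAt (f k) (f (k + 1) y) y) (y : ℝ) :
    HasDerivAt (parts c f) (cubic c y * f 4 y) y := by
  have := ((((hasDerivAt_cubic c y).mul (hf 3 (by norm_num) y)).sub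
    ((hasDerivAt_cubic' c y).mul (hf 2 (by norm_num) y))).add
    ((hasDerivAt_cubic'' c y).mul (hf 1 (by norm_num) y))).sub
    ((hf 0 (by norm_num) y).const_mul (6 * c 3))
  refine this.congr_deriv ?_
  ring

/-- The first derivative of `cubic c * f 0`. -/
def prodDeriv (c : Fin 4 → ℝ) (f : ℕ → ℝ → ℝ) (y : ℝ) : ℝ :=
  cubic' c y * f 0 y + cubic c y * f 1 y

/-- Cell error of the trapezoidal rule for a cubic times an eigenfunction. -/
theorem cell_error {f : ℕ → ℝ → ℝ} {lam B : ℝ} (hlam : lam ≠ 0)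
    (hf : ∀ k < 4, ∀ y, HasDerivAt (f k) (f (k + 1) y) y)
    (heq : ∀ y ∈ Icc (0:ℝ) 1, f 4 y = lam * f 0 y)
    (hB : ∀ k ≤ 4, ∀ y ∈ Icc (0:ℝ) 1, |f k y| ≤ B)
    {c : Fin 4 → ℝ} (hc : ∀ i, |c i| ≤ 1) {a t : ℝ} (ha : 0 ≤ a) (ht : 0 ≤ t)
    (hat : a + t ≤ 1) :
    |t / 2 * (cubic c a * f 0 a + cubic c (a + t) * f 0 (a + t))
      - ((lam⁻¹ * parts c f (a + t) + t ^ 2 / 12 * prodDeriv c f (a + t))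
      - (lam⁻¹ * parts c f a + t ^ 2 / 12 * prodDeriv c f a))| ≤ 100 * B * t ^ 5 := by
  have sub : ∀ y ∈ Icc a (a + t), y ∈ Icc (0:ℝ) 1 := fun y hy =>
    ⟨ha.trans hy.1, hy.2.trans hat⟩
  have d0 := hf 0 (by norm_num)
  have d1 := hf 1 (by norm_num)
  have d2 := hf 2 (by norm_num)
  have d3 := hf 3 (by norm_num)
  refine corrected_trapezoid_error (G := fun y => lam⁻¹ * parts c f y)
    (g := fun y => cubic c y * f 0 y) (g₁ := prodDeriv c f)
    (g₂ := fun y => cubic'' c y * f 0 y + 2 * (cubic' c y * f 1 y) + cubic c y * f 2 y)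
    (g₃ := fun y => 6 * c 3 * f 0 y + 3 * (cubic'' c y * f 1 y) + 3 * (cubic' c y * f 2 y)
      + cubic c y * f 3 y)
    (g₄ := fun y => 24 * c 3 * f 1 y + 6 * (cubic'' c y * f 2 y) + 4 * (cubic' c y * f 3 y)
      + cubic c y * f 4 y) ht ?_ ?_ ?_ ?_ ?_ ?_
  · intro y hy
    refine ((hasDerivAt_parts c hf y).const_mul lam⁻¹).congr_deriv ?_
    rw [heq y (sub y hy)]
    field_simp
  · intro y
    exact (hasDerivAt_cubic c y).mul (d0 y)
  · intro y
    refine (((hasDerivAt_cubic' c y).mul (d0 y)).add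
      ((hasDerivAt_cubic c y).mul (d1 y))).congr_deriv ?_
    ring
  · intro y
    refine ((((hasDerivAt_cubic'' c y).mul (d0 y)).add
      (((hasDerivAt_cubic' c y).mul (d1 y)).const_mul 2)).add
      ((hasDerivAt_cubic c y).mul (d2 y))).congr_deriv ?_
    ring
  · intro y
    refine (((((d0 y).const_mul (6 * c 3)).add
      (((hasDerivAt_cubic'' c y).mul (d1 y)).const_mul 3)).add
      (((hasDerivAt_cubic' c y).mul (d2 y)).const_mul 3)).add
      ((hasDerivAt_cubic c y).mul (d3 y))).congr_deriv ?_
    ring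
  · intro y hy
    have hy' := sub y hy
    have hy1 : |y| ≤ 1 := abs_le.2 ⟨by linarith [hy'.1], hy'.2⟩
    have pw : ∀ (i : Fin 4) (k : ℕ), |c i * y ^ k| ≤ 1 := fun i k => by
      rw [abs_mul, abs_pow]
      exact mul_le_one₀ (hc i) (by positivity) (pow_le_one₀ (abs_nonneg y) hy1)
    have q0 : |cubic c y| ≤ 4 := by
      have h0 := abs_le.1 (pw 0 0); have h1 := abs_le.1 (pw 1 1)
      have h2 := abs_le.1 (pw 2 2); have h3 := abs_le.1 (pw 3 3)
      simp only [pow_zero, pow_one, mul_one] at h0 h1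
      rw [cubic, abs_le]; constructor <;> linarith
    have q1 : |cubic' c y| ≤ 6 := by
      have h1 := abs_le.1 (pw 1 0)
      have h2 := abs_le.1 (pw 2 1); have h3 := abs_le.1 (pw 3 2)
      simp only [pow_zero, pow_one, mul_one] at h1 h2
      rw [cubic', abs_le]; constructor <;> linarith
    have q2 : |cubic'' c y| ≤ 8 := by
      have h2 := abs_le.1 (pw 2 0); have h3 := abs_le.1 (pw 3 1)
      simp only [pow_zero, pow_one, mul_one] at h2 h3
      rw [cubic'', abs_le]; constructor <;> linarith
    have pr : ∀ {p q : ℝ} {k : ℕ}, k ≤ 4 → |p| ≤ q → |p * f k y| ≤ q * B := fun hk hp => by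
      rw [abs_mul]
      exact mul_le_mul hp (hB _ hk y hy') (abs_nonneg _) ((abs_nonneg _).trans hp)
    have p1 := abs_le.1 (pr (k := 1) (by norm_num) (hc 3))
    have p2 := abs_le.1 (pr (k := 2) (by norm_num) q2)
    have p3 := abs_le.1 (pr (k := 3) (by norm_num) q1)
    have p4 := abs_le.1 (pr (k := 4) (by norm_num) q0)
    rw [abs_le]; constructor <;> linarith

/-- Coefficients in `y` of `Kgreen x y` for `y ≤ x`. -/
noncomputable def leftCoeff (x : ℝ) : Fin 4 → ℝ :=
  ![0, 0, (1 - x) ^ 2 * x / 2, - ((1 - x) ^ 2 * (2 * x + 1) / 6)]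

/-- Coefficients in `y` of `Kgreen x y` for `x ≤ y`. -/
noncomputable def rightCoeff (x : ℝ) : Fin 4 → ℝ :=
  ![-(x ^ 3 / 6), x ^ 2 / 2, - (x ^ 2 * (2 - x) / 2), x ^ 2 * (3 - 2 * x) / 6]

theorem Kgreen_of_le {x y : ℝ} (h : y ≤ x) : Kgreen x y = cubic (leftCoeff x) y := by
  simp [Kgreen, h, cubic, leftCoeff]
  ring

theorem Kgreen_of_ge {x y : ℝ} (h : x ≤ y) : Kgreen x y = cubic (rightCoeff x) y := by
  rcases h.eq_or_lt with rfl | h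
  · simp [Kgreen, cubic, rightCoeff]
    ring
  · simp [Kgreen, h.not_ge, cubic, rightCoeff]
    ring

theorem abs_leftCoeff_le {x : ℝ} (hx : x ∈ Icc (0:ℝ) 1) (i : Fin 4) : |leftCoeff x i| ≤ 1 := by
  obtain ⟨h0, h1⟩ := hx
  have h2 : (1 - x) ^ 2 ≤ 1 := by nlinarith
  have h3 := sq_nonneg (1 - x)
  fin_cases i <;> simp only [leftCoeff] <;> simp [abs_le] <;> constructor <;> nlinarith

theorem abs_rightCoeff_le {x : ℝ} (hx : x ∈ Icc (0:ℝ) 1) (i : Fin 4) :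
    |rightCoeff x i| ≤ 1 := by
  obtain ⟨h0, h1⟩ := hx
  have h2 : x ^ 2 ≤ 1 := by nlinarith
  have h3 := sq_nonneg x
  have h4 : x ^ 3 ≤ 1 := pow_le_one₀ h0 h1
  have h5 : 0 ≤ x ^ 3 := by positivity
  fin_cases i <;> simp only [rightCoeff] <;> simp [abs_le] <;> constructor <;> nlinarith

theorem parts_left_zero {f : ℕ → ℝ → ℝ} (x : ℝ) (h0 : f 0 0 = 0) (h1 : f 1 0 = 0) :
    parts (leftCoeff x) f 0 = 0 ∧ prodDeriv (leftCoeff x) f 0 = 0 := by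
  simp [parts, prodDeriv, cubic, cubic', h0, h1, leftCoeff]

theorem parts_right_one {f : ℕ → ℝ → ℝ} (x : ℝ) (h0 : f 0 1 = 0) (h1 : f 1 1 = 0) :
    parts (rightCoeff x) f 1 = 0 ∧ prodDeriv (rightCoeff x) f 1 = 0 := by
  have e0 : cubic (rightCoeff x) 1 = 0 := by
    simp [cubic, rightCoeff]; ring
  have e1 : cubic' (rightCoeff x) 1 = 0 := by
    simp [cubic', rightCoeff]; ring
  simp [parts, prodDeriv, h0, h1, e0, e1]

theorem parts_jump (f : ℕ → ℝ → ℝ) (x : ℝ) :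
    parts (leftCoeff x) f x - parts (rightCoeff x) f x = f 0 x ∧
      prodDeriv (leftCoeff x) f x = prodDeriv (rightCoeff x) f x := by
  constructor <;> simp [parts, prodDeriv, cubic, cubic', cubic'', leftCoeff, rightCoeff] <;> ring

/-- Fourth-order consistency of the discretized Green operator at an eigenfunction. -/
theorem abs_quadrature_sub_le {f : ℕ → ℝ → ℝ} {lam B : ℝ} (hlam : lam ≠ 0)
    (hf : ∀ k < 4, ∀ y, HasDerivAt (f k) (f (k + 1) y) y)
    (heq : ∀ y ∈ Icc (0:ℝ) 1, f 4 y = lam * f 0 y)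
    (hB : ∀ k ≤ 4, ∀ y ∈ Icc (0:ℝ) 1, |f k y| ≤ B)
    (h00 : f 0 0 = 0) (h10 : f 1 0 = 0) (h01 : f 0 1 = 0) (h11 : f 1 1 = 0)
    {N : ℕ} (hN : 2 ≤ N) {n : ℕ} (hn : n ≤ N) :
    |∑ j : Fin (N - 1), (1:ℝ) / N * (Kgreen (n / N) (((j : ℕ) + 1 : ℝ) / N)
        * f 0 (((j : ℕ) + 1 : ℝ) / N)) - lam⁻¹ * f 0 (n / N)|
      ≤ 100 * B * ((1:ℝ) / N) ^ 4 := by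
  have hN0 : (0:ℝ) < N := by exact_mod_cast (by omega : 0 < N)
  set x : ℝ := n / N with hx
  have hx01 : x ∈ Icc (0:ℝ) 1 := ⟨by positivity, by
    rw [hx, div_le_one hN0]; exact_mod_cast hn⟩
  set h : ℝ := 1 / N with hh
  have h0 : 0 ≤ h := by positivity
  let F : (Fin 4 → ℝ) → ℝ → ℝ := fun c y => lam⁻¹ * parts c f y + h ^ 2 / 12 * prodDeriv c f y
  let H : ℕ → ℝ := fun j => if j ≤ n then F (leftCoeff x) (j / N)
    else F (rightCoeff x) (j / N) + (F (leftCoeff x) x - F (rightCoeff x) x)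
  have hHl : ∀ j ≤ n, H j = F (leftCoeff x) (j / N) := fun j hj => if_pos hj
  have hHr : ∀ j, n ≤ j →
      H j = F (rightCoeff x) (j / N) + (F (leftCoeff x) x - F (rightCoeff x) x) := by
    intro j hj
    rcases hj.eq_or_lt with rfl | hj
    · rw [hHl n le_rfl, ← hx]; ring
    · exact if_neg hj.not_ge
  have cell := abs_sum_sub_telescope_le (N := N) (H := H) (e := 100 * B * h ^ 5)
    (a := fun j => h / 2 * (Kgreen x ((j : ℕ) / N) * f 0 ((j : ℕ) / N)
      + Kgreen x ((j + 1 : ℕ) / N) * f 0 ((j + 1 : ℕ) / N))) (by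
    intro j hj
    have e1 : ((j + 1 : ℕ) : ℝ) / N = (j : ℝ) / N + h := by push_cast; rw [hh]; ring
    have hj1 : (j : ℝ) / N + h ≤ 1 := by
      rw [← e1, div_le_one hN0]; exact_mod_cast hj
    have hj0 : (0:ℝ) ≤ (j : ℝ) / N := by positivity
    rcases Nat.lt_or_ge j n with hjn | hjn
    · have l1 : (j : ℝ) / N + h ≤ x := by
        rw [← e1, hx]; gcongr; exact_mod_cast hjn
      rw [hHl _ hjn, hHl _ hjn.le, e1, Kgreen_of_le l1, Kgreen_of_le (by linarith)]
      exact cell_error hlam hf heq hB (abs_leftCoeff_le hx01) hj0 h0 hj1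
    · have l1 : x ≤ (j : ℝ) / N := by rw [hx]; gcongr
      rw [hHr _ hjn, hHr _ (by omega), e1, Kgreen_of_ge l1, Kgreen_of_ge (by linarith),
        add_sub_add_right_eq_sub]
      exact cell_error hlam hf heq hB (abs_rightCoeff_le hx01) hj0 h0 hj1)
  rw [trapezoid_sum_eq hN (fun j => Kgreen x ((j : ℕ) / N) * f 0 ((j : ℕ) / N)) h
    (by simp [h00]) (by simp [div_self hN0.ne', h01]), hHl 0 (Nat.zero_le _), hHr N hn] at cell
  obtain ⟨a1, a2⟩ := parts_left_zero x h00 h10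
  obtain ⟨b1, b2⟩ := parts_right_one x h01 h11
  obtain ⟨c1, c2⟩ := parts_jump f x
  have key : F (rightCoeff x) ((N : ℕ) / N) + (F (leftCoeff x) x - F (rightCoeff x) x)
      - F (leftCoeff x) ((0 : ℕ) / N) = lam⁻¹ * f 0 x := by
    simp only [F, div_self hN0.ne', Nat.cast_zero, zero_div, a1, a2, b1, b2, c2, ← c1]
    ring
  rw [key] at cell
  push_cast at cell
  refine cell.trans (le_of_eq ?_)
  rw [hh]
  field_simp

/-- `0` is not an eigenvalue: a clamped function with vanishing fourth derivative vanishes. -/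
theorem eq_zero_of_fourth_deriv_eq_zero {f : ℕ → ℝ → ℝ}
    (hf : ∀ k < 4, ∀ y, HasDerivAt (f k) (f (k + 1) y) y)
    (heq : ∀ y ∈ Icc (0:ℝ) 1, f 4 y = 0)
    (h00 : f 0 0 = 0) (h10 : f 1 0 = 0) (h01 : f 0 1 = 0) (h11 : f 1 1 = 0)
    {x : ℝ} (hx : x ∈ Icc (0:ℝ) 1) : f 0 x = 0 := by
  have const : ∀ c : Fin 4 → ℝ, ∀ y ∈ Icc (0:ℝ) 1, parts c f y = parts c f 0 := by
    intro c y hy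
    have := abs_le_mul_of_abs_deriv_le_on (f := fun s => parts c f s - parts c f 0)
      (f' := fun _ => 0) (C := 0) hy.1 (fun s hs => by
        refine ((hasDerivAt_parts c hf s).sub_const _).congr_deriv ?_
        rw [heq s ⟨hs.1, hs.2.trans hy.2⟩, mul_zero]) (by simp) (by simp)
    rw [zero_mul] at this
    linarith [abs_nonpos_iff.1 this]
  rw [← (parts_jump f x).1, const _ x hx, (parts_left_zero x h00 h10).1, const _ x hx,
    ← const _ 1 ⟨zero_le_one, le_rfl⟩, (parts_right_one x h01 h11).1, sub_zero]

/-- Riemann sums of `u²` are eventually bounded below when `u` is not identically zero. -/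
theorem riemann_sum_sq_lower {u u' : ℝ → ℝ} (hu : ∀ y, HasDerivAt u (u' y) y) {B : ℝ}
    (hB : ∀ y ∈ Icc (0:ℝ) 1, |u y| ≤ B) (hB' : ∀ y ∈ Icc (0:ℝ) 1, |u' y| ≤ B)
    (h0 : u 0 = 0) (h1 : u 1 = 0) (hne : ∃ x ∈ Icc (0:ℝ) 1, u x ≠ 0) :
    ∃ p > (0:ℝ), ∃ h₀ > (0:ℝ), ∀ N : ℕ, 2 ≤ N → (1:ℝ) / N < h₀ →
      p ≤ ∑ j : Fin (N - 1), (1:ℝ) / N * u (((j : ℕ) + 1 : ℝ) / N) ^ 2 := by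
  have hcont : Continuous u := continuous_iff_continuousAt.2 fun y => (hu y).continuousAt
  have hc2 : Continuous fun y => u y ^ 2 := hcont.pow 2
  let P : ℝ → ℝ := fun x => ∫ y in (0:ℝ)..x, u y ^ 2
  have hP : ∀ x, HasDerivAt P (u x ^ 2) x := fun x => hc2.integral_hasStrictDerivAt 0 x |>.hasDerivAt
  have hP0 : P 0 = 0 := by simp [P]
  have hP1 : 0 < P 1 := by
    obtain ⟨x, hx, hux⟩ := hne
    exact intervalIntegral.integral_pos zero_lt_one hc2.continuousOn
      (fun y _ => sq_nonneg _) ⟨x, hx, by positivity⟩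
  have hB0 : 0 ≤ B := (abs_nonneg _).trans (hB 0 ⟨le_rfl, zero_le_one⟩)
  set L := 2 * B * B with hL
  have hL0 : 0 ≤ L := by positivity
  refine ⟨P 1 / 2, by positivity, P 1 / (2 * (L + 1)), by positivity, ?_⟩
  intro N hN hlt
  have hN0 : (0:ℝ) < N := by exact_mod_cast (by omega : 0 < N)
  set h : ℝ := 1 / N with hh
  have hpos : 0 ≤ h := by positivity
  have cell : ∀ a : ℝ, 0 ≤ a → a + h ≤ 1 →
      |h / 2 * (u a ^ 2 + u (a + h) ^ 2) - (P (a + h) - P a)| ≤ L * h * h := by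
    intro a ha hah
    have sub : ∀ {s : ℝ}, s ∈ Icc 0 h → a + s ∈ Icc (0:ℝ) 1 := fun hs =>
      ⟨by linarith [hs.1], by linarith [hs.2]⟩
    have d2 : ∀ s, HasDerivAt (fun s => u (a + s) ^ 2) (2 * u (a + s) * u' (a + s)) s := by
      intro s
      refine (((hu (a + s)).comp_const_add a s).pow 2).congr_deriv ?_
      ring
    have b2 : ∀ s ∈ Icc 0 h, |2 * u (a + s) * u' (a + s)| ≤ L := by
      intro s hs
      rw [abs_mul, abs_mul, abs_two, hL]
      have := hB _ (sub hs)
      have := hB' _ (sub hs)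
      gcongr
    refine abs_le_mul_of_abs_deriv_le
      (f := fun s => s / 2 * (u a ^ 2 + u (a + s) ^ 2) - (P (a + s) - P a))
      (f' := fun s => (u a ^ 2 - u (a + s) ^ 2) / 2 + s / 2 * (2 * u (a + s) * u' (a + s)))
      hpos ?_ ?_ (by simp)
    · intro s
      refine ((((hasDerivAt_id s).div_const 2).mul ((d2 s).const_add (u a ^ 2))).sub
        (((hP (a + s)).comp_const_add a s).sub_const (P a))).congr_deriv ?_
      simp only [id]
      ring
    · intro s hs
      have k := abs_le.1 (abs_le_mul_of_abs_deriv_le (f := fun s => u (a + s) ^ 2 - u a ^ 2)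
        (C := L) hs.1 (fun r => (d2 r).sub_const _)
        (fun r hr => b2 r ⟨hr.1, hr.2.trans hs.2⟩) (by simp))
      have k2 : |s / 2 * (2 * u (a + s) * u' (a + s))| ≤ s / 2 * L := by
        rw [abs_mul, abs_of_nonneg (by linarith [hs.1] : 0 ≤ s / 2)]
        exact mul_le_mul_of_nonneg_left (b2 s hs) (by linarith [hs.1])
      have k3 := abs_le.1 k2
      have k4 : L * s ≤ L * h := mul_le_mul_of_nonneg_left hs.2 hL0
      rw [abs_le]; constructor <;> linarith
  have tot := abs_sum_sub_telescope_le (N := N) (H := fun j => P ((j : ℕ) / N))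
    (e := L * h * h)
    (a := fun j => h / 2 * (u ((j : ℕ) / N) ^ 2 + u ((j + 1 : ℕ) / N) ^ 2)) (by
    intro j hj
    have e1 : ((j + 1 : ℕ) : ℝ) / N = (j : ℝ) / N + h := by push_cast; rw [hh]; ring
    simp only [e1]
    refine cell _ (by positivity) ?_
    rw [← e1, div_le_one hN0]; exact_mod_cast hj)
  rw [trapezoid_sum_eq hN (fun j => u ((j : ℕ) / N) ^ 2) h (by simp [h0])
    (by simp [div_self hN0.ne', h1])] at tot
  simp only [div_self hN0.ne', Nat.cast_zero, zero_div, hP0, sub_zero] at tot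
  push_cast at tot
  have e2 : (N : ℝ) * (L * h * h) = L * h := by rw [hh]; field_simp
  rw [e2] at tot
  have e3 : L * h ≤ P 1 / 2 := by
    rw [lt_div_iff₀ (by positivity)] at hlt
    nlinarith
  linarith [(abs_le.1 tot).1]

/-- Fourth-order proximity of the discrete spectrum: for every eigenvalue `λ` of the
clamped biharmonic operator there are `C > 0` and `h₀ > 0` such that whenever
`h = 1/N < h₀`, some eigenvalue `μ` of `K^h` satisfies `|λ⁻¹ - μ| ≤ C·h⁴`. -/
theorem discrete_spectrum_fourth_order_proximity
    (lam : ℝ) (hlam : IsClampedBiharmonicEV lam) :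
    ∃ C > (0:ℝ), ∃ h₀ > (0:ℝ), ∀ N : ℕ, 2 ≤ N → (1:ℝ)/N < h₀ →
      ∀ hsym : (Kmat N).IsHermitian,
        ∃ i : Fin (N-1), |lam⁻¹ - hsym.eigenvalues i| ≤ C * ((1:ℝ)/N)^4 := by
  obtain ⟨φ, hφ, hne, heq, h00, h10, h01, h11⟩ := hlam
  have hf : ∀ k < 4, ∀ y, HasDerivAt (iteratedDeriv k φ) (iteratedDeriv (k + 1) φ y) y := by
    intro k hk y
    rw [iteratedDeriv_succ]
    exact (hφ.differentiable_iteratedDeriv k (by exact_mod_cast hk) y).hasDerivAt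
  have hb : ∀ k : Fin 5, ∃ B, ∀ y ∈ Icc (0:ℝ) 1, |iteratedDeriv k φ y| ≤ B := fun k =>
    isCompact_Icc.exists_bound_of_continuousOn
      (hφ.continuous_iteratedDeriv k (by exact_mod_cast Nat.lt_succ_iff.1 k.2)).continuousOn
  choose b hb using hb
  obtain ⟨B, hB⟩ := (Set.finite_range b).bddAbove
  have hB : ∀ k ≤ 4, ∀ y ∈ Icc (0:ℝ) 1, |iteratedDeriv k φ y| ≤ B := fun k hk y hy =>
    (hb ⟨k, by omega⟩ y hy).trans (hB ⟨_, rfl⟩)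
  rw [← iteratedDeriv_one] at h10 h11
  have hz : iteratedDeriv 0 φ = φ := iteratedDeriv_zero
  have hlam : lam ≠ 0 := by
    rintro rfl
    obtain ⟨x, hx, hxne⟩ := hne
    exact hxne (by
      simpa only [hz] using eq_zero_of_fourth_deriv_eq_zero (f := fun k => iteratedDeriv k φ) hf
        (fun y hy => by simpa using heq y hy) (by simpa only [hz] using h00) h10
        (by simpa only [hz] using h01) h11 hx)
  obtain ⟨p, hp, h₀, hh₀, hlow⟩ := riemann_sum_sq_lower (u := φ) (u' := iteratedDeriv 1 φ)
    (fun y => by simpa only [hz] using hf 0 (by norm_num) y)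
    (fun y hy => by simpa only [hz] using hB 0 (by norm_num) y hy) (hB 1 (by norm_num))
    h00 h01 hne
  refine ⟨√((100 * B) ^ 2 / p) + 1, by positivity, h₀, hh₀, ?_⟩
  intro N hN hlt hsym
  have : Nonempty (Fin (N - 1)) := ⟨⟨0, by omega⟩⟩
  have hN0 : (0:ℝ) < N := by exact_mod_cast (by omega : 0 < N)
  let v : Fin (N - 1) → ℝ := fun j => φ (((j : ℕ) + 1 : ℝ) / N)
  obtain ⟨i, hi⟩ := exists_eigenvalue_near hsym lam⁻¹ v
  refine ⟨i, ?_⟩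
  have hv : N * p ≤ ∑ j, v j ^ 2 := by
    have := hlow N hN hlt
    rw [← Finset.mul_sum, one_div, inv_mul_eq_div, le_div_iff₀ hN0] at this
    linarith
  have hr : ∑ j, ((Kmat N).mulVec v j - lam⁻¹ * v j) ^ 2
      ≤ N * (100 * B * ((1:ℝ) / N) ^ 4) ^ 2 := by
    have hle : ∀ j ∈ (Finset.univ : Finset (Fin (N - 1))),
        ((Kmat N).mulVec v j - lam⁻¹ * v j) ^ 2 ≤ (100 * B * ((1:ℝ) / N) ^ 4) ^ 2 := by
      intro j _
      have := abs_quadrature_sub_le (f := fun k => iteratedDeriv k φ) hlam hf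
        (by simpa only [hz] using heq) hB (by simpa only [hz] using h00) h10
        (by simpa only [hz] using h01) h11 hN (n := j + 1) (by omega)
      refine sq_le_sq' ?_ ?_ <;>
      · simp only [hz, Nat.cast_add, Nat.cast_one, abs_le] at this
        simp only [Matrix.mulVec, dotProduct, Kmat, v, mul_assoc] at this ⊢
        linarith [this.1, this.2]
    refine (Finset.sum_le_card_nsmul _ _ _ hle).trans ?_
    rw [nsmul_eq_mul, Finset.card_univ, Fintype.card_fin]
    gcongr
    omega
  have hd : (lam⁻¹ - hsym.eigenvalues i) ^ 2 ≤ (100 * B) ^ 2 / p * (((1:ℝ) / N) ^ 4) ^ 2 := by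
    have h1 : (lam⁻¹ - hsym.eigenvalues i) ^ 2 * (N * p)
        ≤ N * (100 * B * ((1:ℝ) / N) ^ 4) ^ 2 :=
      (mul_le_mul_of_nonneg_left hv (sq_nonneg _)).trans (hi.trans hr)
    rw [div_mul_eq_mul_div, le_div_iff₀ hp, ← mul_pow]
    refine le_of_mul_le_mul_left ?_ hN0
    linarith
  refine abs_le_of_sq_le_sq (hd.trans ?_) (by positivity)
  rw [mul_pow (_ + 1)]
  refine mul_le_mul_of_nonneg_right ?_ (by positivity)
  have h1 := Real.sq_sqrt (by positivity : 0 ≤ (100 * B) ^ 2 / p)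
  nlinarith [Real.sqrt_nonneg ((100 * B) ^ 2 / p)]
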